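/- Let 0<q<1 be real, h'1,…,h'4,l'1,…,l'4,α',μ0,α real, t1,…,t4,ξ nonzero complex numbers and E' ∈ ℂ. Set m = (h'1+h'2+h'3+h'4−l'1−l'2−l'3−l'4−2α'+2)/2, χ = (l'1+l'2+l'3+l'4−h'1−h'2−h'3−h'4)/2, E = q^{2μ0+α−α'+χ}·E', μ = μ0+1+χ, l_i = l'_i+μ0 and h_i = h'_i+μ0+χ for i=1,2,3,4. Assume h satisfies (A⟨2⟩(s; h'1,h'2,h'3,h'4,l'1,l'2,l'3,l'4,α')h)(s) = E'·h(s) for all s ∈ {q^{n}ξ : n∈ℤ}, that h(q^{L}ξ)/(q^{L}ξ)^{m+1} → 0 as L → +∞, and that h(q^{K}ξ)/(q^{K}ξ)^{−α'−1} → 0 as K → −∞. Then for every nonzero complex x with x ∉ {q^{μ0+n}ξ : n∈ℤ}, the Jackson integral g(x) = x^{−α}·∫₀^{ξ∞} s^{−m}·h(s)·P¹_{μ,μ0}(x,s) d_q s converges and satisfies (A⟨2⟩(x; h1,h2,h3,h4,l1,l2,l3,l4,α)g)(x) = E·g(x). -/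

import Mathlib

open Filter Topology

/-- The infinite q-Pochhammer symbol `(a;q)_∞ = ∏_{j=0}^∞ (1 - q^j a)`. -/
noncomputable def qPochInf (q : ℝ) (a : ℂ) : ℂ := ∏' j : ℕ, (1 - (q : ℂ) ^ j * a)

/-- `q^r` for a real exponent `r`, using the principal branch of the complex power. -/
noncomputable def qpow (q : ℝ) (r : ℝ) : ℂ := (q : ℂ) ^ (r : ℂ)

/-- The second degenerate Ruijsenaars–van Diejen operator `A⟨2⟩` applied to `g` at `x`. -/
noncomputable def A2 (q : ℝ) (t1 t2 t3 t4 : ℂ) (h1 h2 h3 h4 l1 l2 l3 l4 a : ℝ)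
    (g : ℂ → ℂ) (x : ℂ) : ℂ :=
  x⁻¹ ^ 2 * ((x - qpow q (h1 + 1/2) * t1) * (x - qpow q (h2 + 1/2) * t2) *
      (x - qpow q (h3 + 1/2) * t3) * (x - qpow q (h4 + 1/2) * t4)) * g (x / (q : ℂ))
    + qpow q (2*a + 1) * x⁻¹ ^ 2 *
        ((x - qpow q (l1 - 1/2) * t1) * (x - qpow q (l2 - 1/2) * t2) *
          (x - qpow q (l3 - 1/2) * t3) * (x - qpow q (l4 - 1/2) * t4)) * g ((q : ℂ) * x)
    + qpow q (a + 1/2) *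
        (-(qpow q (1/2) + qpow q (-(1/2))) * x ^ 2
          + ((qpow q h1 + qpow q l1) * t1 + (qpow q h2 + qpow q l2) * t2
              + (qpow q h3 + qpow q l3) * t3 + (qpow q h4 + qpow q l4) * t4) * x
          + (qpow q ((h1 + l1) / 2) * t1) * (qpow q ((h2 + l2) / 2) * t2) *
              (qpow q ((h3 + l3) / 2) * t3) * (qpow q ((h4 + l4) / 2) * t4) *
              (-(qpow q (1/2) + qpow q (-(1/2))) * x⁻¹ ^ 2
                + ((qpow q (-h1) * t1⁻¹ + qpow q (-l1) * t1⁻¹)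
                    + (qpow q (-h2) * t2⁻¹ + qpow q (-l2) * t2⁻¹)
                    + (qpow q (-h3) * t3⁻¹ + qpow q (-l3) * t3⁻¹)
                    + (qpow q (-h4) * t4⁻¹ + qpow q (-l4) * t4⁻¹)) * x⁻¹)) * g x

/-- `P¹_{μ,μ0}(x,s) = (q^μ s/x;q)_∞ / (q^{μ0} s/x;q)_∞`. -/
noncomputable def P1 (q μ μ0 : ℝ) (x s : ℂ) : ℂ :=
  qPochInf q (qpow q μ * s / x) / qPochInf q (qpow q μ0 * s / x)

/-- The bilateral series `Σ_{n∈ℤ} f n` converges to `S`: the series over `n ≥ 0` and the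
series over `n < 0` both converge, with sum `S`. -/
def HasBilatSum (f : ℤ → ℂ) (S : ℂ) : Prop :=
  ∃ Sp Sm : ℂ,
    Filter.Tendsto (fun N : ℕ => ∑ n ∈ Finset.range N, f n) Filter.atTop (nhds Sp) ∧
    Filter.Tendsto (fun N : ℕ => ∑ n ∈ Finset.range N, f (-(n : ℤ) - 1)) Filter.atTop (nhds Sm) ∧
    S = Sp + Sm

/-- The monic Laurent polynomial `x⁻² ∏ (x - a_i)` in terms of elementary symmetric functions. -/
noncomputable def laurentQuartic (e1 e2 e3 e4 x : ℂ) : ℂ :=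
  x ^ 2 - e1 * x + e2 - e3 * x⁻¹ + e4 * x⁻¹ ^ 2

/-- The zeroth-order coefficient of `A2`, with `r = q^{1/2}`. -/
noncomputable def midCoeff (r c A1 A3 A4 B1 B3 x : ℂ) : ℂ :=
  -(r + r⁻¹) * x ^ 2 + (A1 * r⁻¹ + r * B1) * x
    + (-(r + r⁻¹) * (A4 * c * r⁻¹ ^ 4) * x⁻¹ ^ 2 + (c * r⁻¹ ^ 3 * A3 + r ^ 3 * c⁻¹ * B3) * x⁻¹)

theorem kernel_identity {r c M x s A1 A2 A3 A4 B1 B2 B3 P p p' : ℂ}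
    (hr : r ≠ 0) (hc : c ≠ 0) (hM : M ≠ 0) (hx : x ≠ 0) (hs : s ≠ 0)
    (hp : p * (x - M * c * r ^ 2 * s) = P * (x - M * s))
    (hp' : p' * (x - M * (s / r ^ 2)) = P * (x - M * c * s)) :
    laurentQuartic (M * c * A1) ((M * c) ^ 2 * A2) ((M * c) ^ 3 * A3) ((M * c) ^ 4 * A4) x * p
      + r ^ 2 * laurentQuartic (M * B1) (M ^ 2 * B2) (M ^ 3 * B3)
          (M ^ 4 * (c ^ 2 * A4 * r⁻¹ ^ 8)) x * p'
      + r * midCoeff r c⁻¹ (M * c * A1) ((M * c) ^ 3 * A3) ((M * c) ^ 4 * A4)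
          (M * B1) (M ^ 3 * B3) x * P
    = M ^ 2 * c ^ 2 * laurentQuartic A1 A2 A3 A4 (r ^ 2 * s) * p
      + M ^ 2 * r ^ 2 * laurentQuartic B1 B2 B3 (c ^ 2 * A4 * r⁻¹ ^ 8) (s / r ^ 2) * p'
      + M ^ 2 * c * r * midCoeff r c A1 A3 A4 B1 B3 s * P := by
  have key : ∀ e1 e2 e3 e4 k y : ℂ, k ≠ 0 → y ≠ 0 →
      laurentQuartic (k * e1) (k ^ 2 * e2) (k ^ 3 * e3) (k ^ 4 * e4) x
        - k ^ 2 * laurentQuartic e1 e2 e3 e4 y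
      = (x - k * y) * (x + k * y - k * e1 + k ^ 2 * e3 / (x * y)
          - k ^ 2 * e4 * (x + k * y) / (x ^ 2 * y ^ 2)) := by
    intro e1 e2 e3 e4 k y hk hy
    unfold laurentQuartic
    field_simp
    ring
  have ka := key A1 A2 A3 A4 (M * c) (r ^ 2 * s) (by positivity) (by positivity)
  have kb := key B1 B2 B3 (c ^ 2 * A4 * r⁻¹ ^ 8) M (s / r ^ 2) hM (by positivity)
  set y := r ^ 2 * s with hy
  set z := s / r ^ 2 with hz
  have fin : (x - M * s) * (x + M * c * y - M * c * A1 + (M * c) ^ 2 * A3 / (x * y)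
          - (M * c) ^ 2 * A4 * (x + M * c * y) / (x ^ 2 * y ^ 2))
      + r ^ 2 * (x - M * c * s) * (x + M * z - M * B1 + M ^ 2 * B3 / (x * z)
          - M ^ 2 * (c ^ 2 * A4 * r⁻¹ ^ 8) * (x + M * z) / (x ^ 2 * z ^ 2))
      + r * midCoeff r c⁻¹ (M * c * A1) ((M * c) ^ 3 * A3) ((M * c) ^ 4 * A4)
          (M * B1) (M ^ 3 * B3) x - M ^ 2 * c * r * midCoeff r c A1 A3 A4 B1 B3 s = 0 := by
    rw [hy, hz]
    unfold midCoeff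
    field_simp
    ring
  linear_combination p * ka + r ^ 2 * p' * kb + P * fin +
    (x + M * c * y - M * c * A1 + (M * c) ^ 2 * A3 / (x * y)
          - (M * c) ^ 2 * A4 * (x + M * c * y) / (x ^ 2 * y ^ 2)) * hp +
    r ^ 2 * (x + M * z - M * B1 + M ^ 2 * B3 / (x * z)
          - M ^ 2 * (c ^ 2 * A4 * r⁻¹ ^ 8) * (x + M * z) / (x ^ 2 * z ^ 2)) * hp'

theorem qpow_ne_zero {q : ℝ} (hq : 0 < q) (a : ℝ) : qpow q a ≠ 0 := by
  simp [qpow, Complex.cpow_eq_zero_iff, hq.ne']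

theorem qpow_add {q : ℝ} (hq : 0 < q) (a b : ℝ) : qpow q (a + b) = qpow q a * qpow q b := by
  have : (q : ℂ) ≠ 0 := by exact_mod_cast hq.ne'
  simp [qpow, Complex.cpow_add _ _ this]

theorem qpow_neg (q a : ℝ) : qpow q (-a) = (qpow q a)⁻¹ := by
  simp [qpow, Complex.cpow_neg]

theorem qpow_one (q : ℝ) : qpow q 1 = q := by
  simp [qpow]

theorem qpow_half_sq {q : ℝ} (hq : 0 < q) : qpow q (1 / 2) ^ 2 = q := by
  rw [sq, ← qpow_add hq, ← qpow_one q]; norm_num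

theorem qpow_eq_half_sq {q : ℝ} (hq : 0 < q) (a : ℝ) : qpow q a = qpow q (a / 2) ^ 2 := by
  rw [sq, ← qpow_add hq]; congr 1; ring

theorem qpow_int (q : ℝ) (n : ℤ) : qpow q n = (q : ℂ) ^ n := by
  simp [qpow, Complex.cpow_intCast]

theorem ofReal_mul_cpow {q : ℝ} (hq : 0 < q) {z : ℂ} (hz : z ≠ 0) (a : ℝ) :
    ((q : ℂ) * z) ^ (a : ℂ) = qpow q a * z ^ (a : ℂ) := by
  have : (q : ℂ) ≠ 0 := by exact_mod_cast hq.ne'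
  rw [qpow, Complex.cpow_def_of_ne_zero (mul_ne_zero this hz), Complex.cpow_def_of_ne_zero hz,
    Complex.cpow_def_of_ne_zero this, Complex.log_ofReal_mul hq hz, ← Complex.exp_add,
    Complex.ofReal_log hq.le]
  ring_nf

theorem A2_eq_laurent {q : ℝ} (hq : 0 < q) {t1 t2 t3 t4 : ℂ}
    (ht1 : t1 ≠ 0) (ht2 : t2 ≠ 0) (ht3 : t3 ≠ 0) (ht4 : t4 ≠ 0)
    (h1 h2 h3 h4 l1 l2 l3 l4 a : ℝ) (g : ℂ → ℂ) {x : ℂ} (hx : x ≠ 0)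
    {r c a1 a2 a3 a4 b1 b2 b3 b4 : ℂ} (hr : r = qpow q (1 / 2))
    (hc : c = qpow q ((l1 + l2 + l3 + l4 - h1 - h2 - h3 - h4) / 2))
    (ha1 : a1 = qpow q h1 * r * t1) (ha2 : a2 = qpow q h2 * r * t2)
    (ha3 : a3 = qpow q h3 * r * t3) (ha4 : a4 = qpow q h4 * r * t4)
    (hb1 : b1 = qpow q l1 * r⁻¹ * t1) (hb2 : b2 = qpow q l2 * r⁻¹ * t2)
    (hb3 : b3 = qpow q l3 * r⁻¹ * t3) (hb4 : b4 = qpow q l4 * r⁻¹ * t4) :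
    A2 q t1 t2 t3 t4 h1 h2 h3 h4 l1 l2 l3 l4 a g x =
      laurentQuartic (a1 + a2 + a3 + a4)
          (a1 * a2 + a1 * a3 + a1 * a4 + a2 * a3 + a2 * a4 + a3 * a4)
          (a1 * a2 * a3 + a1 * a2 * a4 + a1 * a3 * a4 + a2 * a3 * a4)
          (a1 * a2 * a3 * a4) x * g (x / q)
      + qpow q a ^ 2 * r ^ 2 * laurentQuartic (b1 + b2 + b3 + b4)
          (b1 * b2 + b1 * b3 + b1 * b4 + b2 * b3 + b2 * b4 + b3 * b4)
          (b1 * b2 * b3 + b1 * b2 * b4 + b1 * b3 * b4 + b2 * b3 * b4)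
          (c ^ 2 * (a1 * a2 * a3 * a4) * r⁻¹ ^ 8) x * g (q * x)
      + qpow q a * r * midCoeff r c (a1 + a2 + a3 + a4)
          (a1 * a2 * a3 + a1 * a2 * a4 + a1 * a3 * a4 + a2 * a3 * a4) (a1 * a2 * a3 * a4)
          (b1 + b2 + b3 + b4) (b1 * b2 * b3 + b1 * b2 * b4 + b1 * b3 * b4 + b2 * b3 * b4) x
          * g x := by
  have hr0 : r ≠ 0 := hr ▸ qpow_ne_zero hq _
  have hc' : c = qpow q (l1 / 2) * qpow q (l2 / 2) * qpow q (l3 / 2) * qpow q (l4 / 2) *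
      (qpow q (h1 / 2) * qpow q (h2 / 2) * qpow q (h3 / 2) * qpow q (h4 / 2))⁻¹ := by
    rw [hc]
    simp only [← qpow_add hq, ← qpow_neg]
    congr 1; ring
  have h2a : qpow q (2 * a + 1) = qpow q a ^ 2 * r ^ 2 := by
    rw [hr, sq, sq, ← qpow_add hq, ← qpow_add hq, ← qpow_add hq]; congr 1; ring
  have key : ∀ a1 a2 a3 a4 : ℂ, x⁻¹ ^ 2 * ((x - a1) * (x - a2) * (x - a3) * (x - a4)) =
      laurentQuartic (a1 + a2 + a3 + a4)
          (a1 * a2 + a1 * a3 + a1 * a4 + a2 * a3 + a2 * a4 + a3 * a4)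
          (a1 * a2 * a3 + a1 * a2 * a4 + a1 * a3 * a4 + a2 * a3 * a4)
          (a1 * a2 * a3 * a4) x := by
    intro a1 a2 a3 a4
    unfold laurentQuartic
    field_simp
    ring
  have hu : ∀ y, qpow q y ≠ 0 := qpow_ne_zero hq
  have hb : c ^ 2 * (a1 * a2 * a3 * a4) * r⁻¹ ^ 8 = b1 * b2 * b3 * b4 := by
    rw [hc', ha1, ha2, ha3, ha4, hb1, hb2, hb3, hb4, qpow_eq_half_sq hq h1, qpow_eq_half_sq hq h2,
      qpow_eq_half_sq hq h3, qpow_eq_half_sq hq h4, qpow_eq_half_sq hq l1, qpow_eq_half_sq hq l2,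
      qpow_eq_half_sq hq l3, qpow_eq_half_sq hq l4]
    have := hu (h1 / 2)
    have := hu (h2 / 2)
    have := hu (h3 / 2)
    have := hu (h4 / 2)
    field_simp
  rw [hb, ← key, ← key]
  unfold A2
  have e1 : ∀ y, qpow q (y + 1 / 2) = qpow q y * r := fun y => by rw [qpow_add hq, hr]
  have e2 : ∀ y, qpow q (y - 1 / 2) = qpow q y * r⁻¹ := fun y => by
    rw [sub_eq_add_neg, qpow_add hq, hr, qpow_neg]
  have e3 : qpow q (-(1 / 2)) = r⁻¹ := by rw [hr, qpow_neg]
  have hmid : (-(r + r⁻¹) * x ^ 2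
          + ((qpow q h1 + qpow q l1) * t1 + (qpow q h2 + qpow q l2) * t2
              + (qpow q h3 + qpow q l3) * t3 + (qpow q h4 + qpow q l4) * t4) * x
          + (qpow q ((h1 + l1) / 2) * t1) * (qpow q ((h2 + l2) / 2) * t2) *
              (qpow q ((h3 + l3) / 2) * t3) * (qpow q ((h4 + l4) / 2) * t4) *
              (-(r + r⁻¹) * x⁻¹ ^ 2
                + ((qpow q (-h1) * t1⁻¹ + qpow q (-l1) * t1⁻¹)
                    + (qpow q (-h2) * t2⁻¹ + qpow q (-l2) * t2⁻¹)
                    + (qpow q (-h3) * t3⁻¹ + qpow q (-l3) * t3⁻¹)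
                    + (qpow q (-h4) * t4⁻¹ + qpow q (-l4) * t4⁻¹)) * x⁻¹)) =
      midCoeff r c (a1 + a2 + a3 + a4)
          (a1 * a2 * a3 + a1 * a2 * a4 + a1 * a3 * a4 + a2 * a3 * a4) (a1 * a2 * a3 * a4)
          (b1 + b2 + b3 + b4) (b1 * b2 * b3 + b1 * b2 * b4 + b1 * b3 * b4 + b2 * b3 * b4) x := by
    have e4 : ∀ y z, qpow q ((y + z) / 2) = qpow q (y / 2) * qpow q (z / 2) := fun y z => by
      rw [← qpow_add hq]; congr 1; ring
    rw [hc', ha1, ha2, ha3, ha4, hb1, hb2, hb3, hb4]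
    simp only [e4, qpow_neg]
    rw [qpow_eq_half_sq hq h1, qpow_eq_half_sq hq h2,
      qpow_eq_half_sq hq h3, qpow_eq_half_sq hq h4, qpow_eq_half_sq hq l1, qpow_eq_half_sq hq l2,
      qpow_eq_half_sq hq l3, qpow_eq_half_sq hq l4]
    have := hu (h1 / 2)
    have := hu (h2 / 2)
    have := hu (h3 / 2)
    have := hu (h4 / 2)
    have := hu (l1 / 2)
    have := hu (l2 / 2)
    have := hu (l3 / 2)
    have := hu (l4 / 2)
    generalize qpow q (h1 / 2) = u1 at *
    generalize qpow q (h2 / 2) = u2 at *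
    generalize qpow q (h3 / 2) = u3 at *
    generalize qpow q (h4 / 2) = u4 at *
    generalize qpow q (l1 / 2) = v1 at *
    generalize qpow q (l2 / 2) = v2 at *
    generalize qpow q (l3 / 2) = v3 at *
    generalize qpow q (l4 / 2) = v4 at *
    clear ha1 ha2 ha3 ha4 hb1 hb2 hb3 hb4 hb hc hc' h2a e1 e2 e3 e4 hr hu key
    unfold midCoeff
    field_simp
    ring
  rw [h2a, e3]
  simp only [e1, e2, ← hr, ← ha1, ← ha2, ← ha3, ← ha4, ← hb1, ← hb2, ← hb3, ← hb4]
  rw [hmid]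
  ring

theorem qPochInf_eq_mul {q : ℝ} (hq0 : 0 < q) (hq1 : q < 1) (a : ℂ) :
    qPochInf q a = (1 - a) * qPochInf q (q * a) := by
  have hs : Summable fun j : ℕ => ‖-((q : ℂ) ^ j * (q * a))‖ := by
    simp only [norm_neg, norm_mul, norm_pow, Complex.norm_real, Real.norm_of_nonneg hq0.le]
    exact (summable_geometric_of_lt_one hq0.le hq1).mul_right _
  have hm := multipliable_one_add_of_summable hs
  unfold qPochInf
  rw [tprod_eq_zero_mul']
  · simp [pow_succ, mul_assoc]
  · refine hm.congr fun j => ?_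
    ring

theorem P1_mul_left {q μ μ0 : ℝ} {x s k : ℂ} (hk : k ≠ 0) :
    P1 q μ μ0 (x / k) s = P1 q μ μ0 x (k * s) := by
  unfold P1
  congr 2 <;> field_simp

theorem P1_shift {q μ μ0 : ℝ} (hq0 : 0 < q) (hq1 : q < 1) {x s : ℂ} (hx : x ≠ 0)
    (hs : x ≠ qpow q μ0 * s) :
    P1 q μ μ0 x (q * s) * (x - qpow q μ * s) = P1 q μ μ0 x s * (x - qpow q μ0 * s) := by
  have hB : 1 - qpow q μ0 * s / x ≠ 0 := by
    rw [sub_ne_zero]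
    intro h
    apply hs
    field_simp at h
    exact h
  unfold P1
  rw [qPochInf_eq_mul hq0 hq1 (qpow q μ * s / x), qPochInf_eq_mul hq0 hq1 (qpow q μ0 * s / x),
    show qpow q μ * (q * s) / x = q * (qpow q μ * s / x) by ring,
    show qpow q μ0 * (q * s) / x = q * (qpow q μ0 * s / x) by ring,
    show x - qpow q μ * s = x * (1 - qpow q μ * s / x) by field_simp,
    show x - qpow q μ0 * s = x * (1 - qpow q μ0 * s / x) by field_simp]
  generalize qPochInf q (q * (qpow q μ0 * s / x)) = d
  generalize 1 - qpow q μ0 * s / x = e at *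
  by_cases hd : d = 0
  · simp [hd]
  · field_simp

theorem bounded_of_recurrence {ρ : ℝ} (h0 : 0 < ρ) (h1 : ρ < 1) (a b : ℂ) (v : ℕ → ℂ)
    (hv : ∀ k, v (k + 1) * (1 - a * (ρ : ℂ) ^ k) = v k * (1 - b * (ρ : ℂ) ^ k)) :
    v =O[atTop] (fun _ => (1 : ℝ)) := by
  set C : ℝ := 2 * ‖a‖ + ‖b‖ with hC
  have hlim : Tendsto (fun k : ℕ => ‖a‖ * ρ ^ k) atTop (𝓝 0) := by
    simpa using (tendsto_pow_atTop_nhds_zero_of_lt_one h0.le h1).const_mul ‖a‖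
  obtain ⟨N, hN⟩ := eventually_atTop.1 (hlim.eventually (ge_mem_nhds (by norm_num : (0:ℝ) < 1 / 2)))
  have hstep : ∀ k ≥ N, ‖v (k + 1)‖ ≤ ‖v k‖ * Real.exp (C * ρ ^ k) := by
    intro k hk
    have hy : ‖a‖ * ρ ^ k ≤ 1 / 2 := hN k hk
    have hna : ‖a * (ρ : ℂ) ^ k‖ = ‖a‖ * ρ ^ k := by simp [abs_of_pos h0]
    have hnb : ‖b * (ρ : ℂ) ^ k‖ = ‖b‖ * ρ ^ k := by simp [abs_of_pos h0]
    have hl : 1 - ‖a‖ * ρ ^ k ≤ ‖1 - a * (ρ : ℂ) ^ k‖ := by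
      have := norm_sub_norm_le (1 : ℂ) (a * (ρ : ℂ) ^ k)
      rwa [hna, norm_one] at this
    have hu : ‖1 - b * (ρ : ℂ) ^ k‖ ≤ 1 + ‖b‖ * ρ ^ k := by
      have := norm_sub_le (1 : ℂ) (b * (ρ : ℂ) ^ k)
      rwa [hnb, norm_one] at this
    have heq := congrArg norm (hv k)
    rw [norm_mul, norm_mul] at heq
    set y := ‖a‖ * ρ ^ k
    have hy0 : 0 ≤ y := by positivity
    have hz0 : 0 ≤ ‖b‖ * ρ ^ k := by positivity
    have hA : ‖v (k + 1)‖ * (1 - y) ≤ ‖v k‖ * (1 + ‖b‖ * ρ ^ k) :=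
      (mul_le_mul_of_nonneg_left hl (norm_nonneg _)).trans
        (heq.le.trans (mul_le_mul_of_nonneg_left hu (norm_nonneg _)))
    have hB : ‖v (k + 1)‖ ≤ ‖v (k + 1)‖ * (1 - y) * (1 + 2 * y) := by
      have : 1 ≤ (1 - y) * (1 + 2 * y) := by nlinarith
      rw [mul_assoc]
      exact le_mul_of_one_le_right (norm_nonneg _) this
    calc ‖v (k + 1)‖ ≤ ‖v k‖ * (1 + ‖b‖ * ρ ^ k) * (1 + 2 * y) :=
          hB.trans (mul_le_mul_of_nonneg_right hA (by positivity))
      _ ≤ ‖v k‖ * Real.exp (‖b‖ * ρ ^ k) * Real.exp (2 * y) := by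
          gcongr
          · linarith [Real.add_one_le_exp (‖b‖ * ρ ^ k)]
          · linarith [Real.add_one_le_exp (2 * y)]
      _ = _ := by
          rw [mul_assoc, ← Real.exp_add]
          congr 2
          simp only [y, hC]
          ring
  have hρ : 0 < 1 - ρ := by linarith
  have hmono : ∀ k ≥ N, ‖v k‖ * Real.exp (C * ρ ^ k / (1 - ρ)) ≤
      ‖v N‖ * Real.exp (C * ρ ^ N / (1 - ρ)) := by
    intro k hk
    induction k, hk using Nat.le_induction with
    | base => exact le_rfl
    | succ k hk ih =>
      refine le_trans ?_ ih
      refine (mul_le_mul_of_nonneg_right (hstep k hk) (Real.exp_nonneg _)).trans (le_of_eq ?_)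
      rw [mul_assoc, ← Real.exp_add]
      congr 2
      field_simp
      ring
  refine Asymptotics.IsBigO.of_bound (‖v N‖ * Real.exp (C * ρ ^ N / (1 - ρ))) ?_
  filter_upwards [eventually_ge_atTop N] with k hk
  rw [norm_one, mul_one]
  refine le_trans (le_mul_of_one_le_right (norm_nonneg _) ?_) (hmono k hk)
  exact Real.one_le_exp (by positivity)

theorem HasBilatSum.const_mul {f : ℤ → ℂ} {S : ℂ} (c : ℂ) (hf : HasBilatSum f S) :
    HasBilatSum (fun n => c * f n) (c * S) := by
  obtain ⟨Sp, Sm, h1, h2, rfl⟩ := hf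
  refine ⟨c * Sp, c * Sm, ?_, ?_, by ring⟩
  · simpa only [Finset.mul_sum] using h1.const_mul c
  · simpa only [Finset.mul_sum] using h2.const_mul c

theorem HasBilatSum.add {f g : ℤ → ℂ} {S T : ℂ} (hf : HasBilatSum f S) (hg : HasBilatSum g T) :
    HasBilatSum (fun n => f n + g n) (S + T) := by
  obtain ⟨Sp, Sm, h1, h2, rfl⟩ := hf
  obtain ⟨Tp, Tm, h3, h4, rfl⟩ := hg
  refine ⟨Sp + Tp, Sm + Tm, ?_, ?_, by ring⟩
  · simpa only [Finset.sum_add_distrib] using h1.add h3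
  · simpa only [Finset.sum_add_distrib] using h2.add h4

theorem HasBilatSum.unique {f : ℤ → ℂ} {S T : ℂ} (hf : HasBilatSum f S) (hg : HasBilatSum f T) :
    S = T := by
  obtain ⟨Sp, Sm, h1, h2, rfl⟩ := hf
  obtain ⟨Tp, Tm, h3, h4, rfl⟩ := hg
  rw [tendsto_nhds_unique h1 h3, tendsto_nhds_unique h2 h4]

theorem tendsto_neg_natCast_sub_one_atBot :
    Tendsto (fun N : ℕ => -(N : ℤ) - 1) atTop atBot :=
  tendsto_atBot_add_const_right _ (-1) (tendsto_neg_atTop_atBot.comp tendsto_natCast_atTop_atTop)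

theorem hasBilatSum_telescope {Z : ℤ → ℂ} (ht : Tendsto Z atTop (𝓝 0))
    (hb : Tendsto Z atBot (𝓝 0)) : HasBilatSum (fun n => Z (n + 1) - Z n) 0 := by
  refine ⟨0 - Z 0, Z 0 - 0, ?_, ?_, by ring⟩
  · have : ∀ N : ℕ, ∑ n ∈ Finset.range N, (Z ((n : ℤ) + 1) - Z n) = Z N - Z 0 := fun N => by
      simpa using Finset.sum_range_sub (fun n : ℕ => Z n) N
    simp only [this]
    exact (ht.comp tendsto_natCast_atTop_atTop).sub_const _
  · have : ∀ N : ℕ, ∑ n ∈ Finset.range N, (Z (-(n : ℤ) - 1 + 1) - Z (-(n : ℤ) - 1)) =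
        Z 0 - Z (-N) := fun N => by
      have h := Finset.sum_range_sub' (fun n : ℕ => Z (-(n : ℤ))) N
      simp only [Nat.cast_add, Nat.cast_one, Nat.cast_zero, neg_zero] at h
      rw [← h]
      refine Finset.sum_congr rfl fun n _ => ?_
      congr 2 <;> ring
    simp only [this]
    exact (hb.comp (tendsto_neg_atTop_atBot.comp tendsto_natCast_atTop_atTop)).const_sub _

theorem tendsto_zpow_mul_atTop {q : ℝ} (hq0 : 0 < q) (hq1 : q < 1) (ξ : ℂ) :
    Tendsto (fun n : ℤ => (q : ℂ) ^ n * ξ) atTop (𝓝 0) := by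
  have h : Tendsto (fun n : ℤ => (q : ℂ) ^ n) atTop (𝓝 0) := by
    rw [tendsto_zero_iff_norm_tendsto_zero]
    refine ((tendsto_rpow_atTop_of_base_lt_one q (by linarith) hq1).comp
      (tendsto_intCast_atTop_atTop (R := ℝ))).congr fun n => ?_
    simp [abs_of_pos hq0]
  simpa using h.mul_const ξ

theorem tendsto_inv_zpow_mul_atBot {q : ℝ} (hq0 : 0 < q) (hq1 : q < 1) (ξ : ℂ) :
    Tendsto (fun n : ℤ => ((q : ℂ) ^ n * ξ)⁻¹) atBot (𝓝 0) := by
  have h := (tendsto_zpow_mul_atTop hq0 hq1 ξ⁻¹).comp tendsto_neg_atBot_atTop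
  refine h.congr fun n => ?_
  simp [zpow_neg, mul_comm]

theorem summable_of_tendsto_mul_inv_sq {q : ℝ} (hq0 : 0 < q) (hq1 : q < 1) {η : ℂ} (hη : η ≠ 0)
    {y : ℕ → ℂ} (hy : Tendsto (fun k => y k * ((q : ℂ) ^ k * η)⁻¹ ^ 2) atTop (𝓝 0)) :
    Summable y := by
  have hqc : (q : ℂ) ≠ 0 := by exact_mod_cast hq0.ne'
  have hg : Summable fun k : ℕ => (q ^ 2) ^ k :=
    summable_geometric_of_lt_one (by positivity) (by nlinarith)
  refine summable_of_isBigO_nat (hg.mul_right (‖η‖ ^ 2)) ?_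
  have := (hy.isBigO_one ℝ).mul
    (Asymptotics.isBigO_refl (fun k : ℕ => ((q : ℂ) ^ k * η) ^ 2) atTop).norm_right
  refine this.congr (fun k => ?_) fun k => ?_
  · field_simp
  · simp only [norm_pow, norm_mul, Complex.norm_real, Real.norm_of_nonneg hq0.le]
    ring

theorem exists_hasBilatSum {q : ℝ} (hq0 : 0 < q) (hq1 : q < 1) {ξ : ℂ} (hξ : ξ ≠ 0) {Y : ℤ → ℂ}
    (ht : Tendsto (fun n => Y n * ((q : ℂ) ^ n * ξ)⁻¹ ^ 2) atTop (𝓝 0))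
    (hb : Tendsto (fun n => Y n * ((q : ℂ) ^ n * ξ) ^ 2) atBot (𝓝 0)) :
    ∃ S, HasBilatSum Y S := by
  have hqc : (q : ℂ) ≠ 0 := by exact_mod_cast hq0.ne'
  have h1 : Summable fun k : ℕ => Y k := by
    refine summable_of_tendsto_mul_inv_sq hq0 hq1 hξ ?_
    simpa [Function.comp_def] using ht.comp tendsto_natCast_atTop_atTop
  have h2 : Summable fun k : ℕ => Y (-(k : ℤ) - 1) := by
    refine summable_of_tendsto_mul_inv_sq hq0 hq1 (div_ne_zero hqc hξ) ?_
    refine (hb.comp tendsto_neg_natCast_sub_one_atBot).congr fun k => ?_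
    simp only [Function.comp]
    rw [zpow_sub₀ hqc, zpow_neg, zpow_natCast, zpow_one]
    congr 2
    field_simp
  exact ⟨_, _, _, h1.hasSum.tendsto_sum_nat, h2.hasSum.tendsto_sum_nat, rfl⟩

theorem tendsto_laurentQuartic_mul_atTop {q : ℝ} (hq0 : 0 < q) (hq1 : q < 1) {ξ k : ℂ}
    (hξ : ξ ≠ 0) (hk : k ≠ 0) {Y : ℤ → ℂ}
    (ht : Tendsto (fun n => Y n * ((q : ℂ) ^ n * ξ)⁻¹ ^ 2) atTop (𝓝 0)) (e1 e2 e3 e4 : ℂ) :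
    Tendsto (fun n => laurentQuartic e1 e2 e3 e4 (k * ((q : ℂ) ^ n * ξ)) * Y n) atTop (𝓝 0) := by
  have hqc : (q : ℂ) ≠ 0 := by exact_mod_cast hq0.ne'
  have hc : Continuous fun z : ℂ =>
      k ^ 2 * z ^ 4 - e1 * k * z ^ 3 + e2 * z ^ 2 - e3 * k⁻¹ * z + e4 * k⁻¹ ^ 2 := by fun_prop
  have h := ((hc.tendsto 0).comp (tendsto_zpow_mul_atTop hq0 hq1 ξ)).mul ht
  rw [mul_zero] at h
  refine h.congr fun n => ?_
  simp only [Function.comp, laurentQuartic]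
  have : (q : ℂ) ^ n * ξ ≠ 0 := mul_ne_zero (zpow_ne_zero _ hqc) hξ
  generalize (q : ℂ) ^ n * ξ = z at *
  field_simp

theorem tendsto_laurentQuartic_mul_atBot {q : ℝ} (hq0 : 0 < q) (hq1 : q < 1) {ξ k : ℂ}
    (hξ : ξ ≠ 0) (hk : k ≠ 0) {Y : ℤ → ℂ}
    (hb : Tendsto (fun n => Y n * ((q : ℂ) ^ n * ξ) ^ 2) atBot (𝓝 0)) (e1 e2 e3 e4 : ℂ) :
    Tendsto (fun n => laurentQuartic e1 e2 e3 e4 (k * ((q : ℂ) ^ n * ξ)) * Y n) atBot (𝓝 0) := by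
  have hqc : (q : ℂ) ≠ 0 := by exact_mod_cast hq0.ne'
  have hc : Continuous fun z : ℂ =>
      k ^ 2 - e1 * k * z + e2 * z ^ 2 - e3 * k⁻¹ * z ^ 3 + e4 * k⁻¹ ^ 2 * z ^ 4 := by fun_prop
  have h := ((hc.tendsto 0).comp (tendsto_inv_zpow_mul_atBot hq0 hq1 ξ)).mul hb
  rw [mul_zero] at h
  refine h.congr fun n => ?_
  simp only [Function.comp, laurentQuartic]
  have : (q : ℂ) ^ n * ξ ≠ 0 := mul_ne_zero (zpow_ne_zero _ hqc) hξ
  generalize (q : ℂ) ^ n * ξ = z at *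
  field_simp

/-- Summation by parts: the eigenvalue equation is carried from `G` to the bilateral transform with
kernel `P`. -/
theorem bilatSum_eigen {q : ℝ} (hq0 : 0 < q) (hq1 : q < 1) {ξ r c M α x A1 A2 A3 A4 B1 B2 B3 : ℂ}
    {E' : ℂ} (hξ : ξ ≠ 0) (hr : r ≠ 0) (hrq : r ^ 2 = q) (hc : c ≠ 0) (hM : M ≠ 0) (hα : α ≠ 0)
    (hx : x ≠ 0) {G P : ℤ → ℂ}
    (hP : ∀ n, P (n + 1) * (x - M * c * q * ((q : ℂ) ^ n * ξ)) =
      P n * (x - M * ((q : ℂ) ^ n * ξ)))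
    (hG : ∀ n, E' * G n =
      c * α * laurentQuartic A1 A2 A3 A4 ((q : ℂ) ^ n * ξ) * G (n - 1)
      + α * r ^ 2 * c⁻¹ * laurentQuartic B1 B2 B3 (c ^ 2 * A4 * r⁻¹ ^ 8) ((q : ℂ) ^ n * ξ)
          * G (n + 1)
      + α * r * midCoeff r c A1 A3 A4 B1 B3 ((q : ℂ) ^ n * ξ) * G n)
    (ht : ∀ j : ℤ, Tendsto (fun n => G n * P (n + j) * ((q : ℂ) ^ n * ξ)⁻¹ ^ 2) atTop (𝓝 0))
    (hb : ∀ j : ℤ, Tendsto (fun n => G n * P (n + j) * ((q : ℂ) ^ n * ξ) ^ 2) atBot (𝓝 0))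
    {J0 Jp Jm : ℂ} (hJ0 : HasBilatSum (fun n => G n * P n) J0)
    (hJp : HasBilatSum (fun n => G n * P (n + 1)) Jp)
    (hJm : HasBilatSum (fun n => G n * P (n - 1)) Jm) :
    laurentQuartic (M * c * A1) ((M * c) ^ 2 * A2) ((M * c) ^ 3 * A3) ((M * c) ^ 4 * A4) x * Jp
      + r ^ 2 * laurentQuartic (M * B1) (M ^ 2 * B2) (M ^ 3 * B3)
          (M ^ 4 * (c ^ 2 * A4 * r⁻¹ ^ 8)) x * Jm
      + r * midCoeff r c⁻¹ (M * c * A1) ((M * c) ^ 3 * A3) ((M * c) ^ 4 * A4)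
          (M * B1) (M ^ 3 * B3) x * J0
    = M ^ 2 * c * α⁻¹ * E' * J0 := by
  have hqc : (q : ℂ) ≠ 0 := by exact_mod_cast hq0.ne'
  set B4 := c ^ 2 * A4 * r⁻¹ ^ 8 with hB4
  set u : ℤ → ℂ := fun n =>
    laurentQuartic A1 A2 A3 A4 (q * ((q : ℂ) ^ n * ξ)) * (G n * P (n + 1)) with hu
  set v : ℤ → ℂ := fun n =>
    laurentQuartic B1 B2 B3 B4 ((q : ℂ)⁻¹ * ((q : ℂ) ^ n * ξ)) * (G n * P (n + -1)) with hv
  set Z : ℤ → ℂ := fun n => M ^ 2 * c ^ 2 * u (n - 1) - M ^ 2 * r ^ 2 * v n with hZ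
  have hut : Tendsto u atTop (𝓝 0) :=
    tendsto_laurentQuartic_mul_atTop hq0 hq1 hξ hqc (ht 1) _ _ _ _
  have hub : Tendsto u atBot (𝓝 0) :=
    tendsto_laurentQuartic_mul_atBot hq0 hq1 hξ hqc (hb 1) _ _ _ _
  have hvt : Tendsto v atTop (𝓝 0) :=
    tendsto_laurentQuartic_mul_atTop hq0 hq1 hξ (inv_ne_zero hqc) (ht (-1)) _ _ _ _
  have hvb : Tendsto v atBot (𝓝 0) :=
    tendsto_laurentQuartic_mul_atBot hq0 hq1 hξ (inv_ne_zero hqc) (hb (-1)) _ _ _ _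
  have hZt : Tendsto Z atTop (𝓝 0) := by
    simpa [hZ, sub_eq_add_neg] using ((hut.comp (tendsto_atTop_add_const_right atTop (-1) tendsto_id)).const_mul
      (M ^ 2 * c ^ 2)).sub (hvt.const_mul (M ^ 2 * r ^ 2))
  have hZb : Tendsto Z atBot (𝓝 0) := by
    simpa [hZ, sub_eq_add_neg] using ((hub.comp (tendsto_atBot_add_const_right atBot (-1) tendsto_id)).const_mul
      (M ^ 2 * c ^ 2)).sub (hvb.const_mul (M ^ 2 * r ^ 2))
  have hsum := (((hJp.const_mul (laurentQuartic (M * c * A1) ((M * c) ^ 2 * A2) ((M * c) ^ 3 * A3)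
      ((M * c) ^ 4 * A4) x)).add (hJm.const_mul (r ^ 2 * laurentQuartic (M * B1) (M ^ 2 * B2)
        (M ^ 3 * B3) (M ^ 4 * B4) x))).add (hJ0.const_mul (r * midCoeff r c⁻¹ (M * c * A1)
          ((M * c) ^ 3 * A3) ((M * c) ^ 4 * A4) (M * B1) (M ^ 3 * B3) x))).add
        (hJ0.const_mul (-(M ^ 2 * c * α⁻¹ * E')))
  have htel := hasBilatSum_telescope hZt hZb
  have hzero := hsum.unique (T := 0) (by
    convert htel using 1
    funext n
    have hp' := hP (n - 1)
    have hs0 : (q : ℂ) ^ n * ξ ≠ 0 := mul_ne_zero (zpow_ne_zero _ hqc) hξ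
    have hp := hP n
    have eu : u (n - 1) = laurentQuartic A1 A2 A3 A4 ((q : ℂ) ^ n * ξ) * (G (n - 1) * P n) := by
      simp only [hu, zpow_sub_one₀ hqc, sub_add_cancel]
      congr 2
      field_simp
    have ev : v (n + 1) = laurentQuartic B1 B2 B3 B4 ((q : ℂ) ^ n * ξ) * (G (n + 1) * P n) := by
      simp only [hv, zpow_add_one₀ hqc, add_neg_cancel_right]
      congr 2
      field_simp
    rw [show (q : ℂ) ^ (n - 1) * ξ = (q : ℂ) ^ n * ξ / r ^ 2 by
      rw [zpow_sub_one₀ hqc, hrq]; ring, sub_add_cancel] at hp'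
    have hker := kernel_identity (A1 := A1) (A2 := A2) (A3 := A3) (A4 := A4) (B1 := B1) (B2 := B2)
      (B3 := B3) (P := P n) (p := P (n + 1)) (p' := P (n - 1)) hr hc hM hx hs0
      (by rw [hrq]; exact hp)
      (by rw [← hp', ← hrq]; field_simp)
    rw [← hB4] at hker
    have hg : M ^ 2 * c * α⁻¹ * E' * G n =
        M ^ 2 * c ^ 2 * laurentQuartic A1 A2 A3 A4 ((q : ℂ) ^ n * ξ) * G (n - 1)
        + M ^ 2 * r ^ 2 * laurentQuartic B1 B2 B3 B4 ((q : ℂ) ^ n * ξ) * G (n + 1)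
        + M ^ 2 * c * r * midCoeff r c A1 A3 A4 B1 B3 ((q : ℂ) ^ n * ξ) * G n := by
      rw [mul_assoc, hG n]
      field_simp
    simp only [hZ, add_sub_cancel_right, eu, ev]
    simp only [hu, hv, ← sub_eq_add_neg]
    rw [show (q : ℂ)⁻¹ * ((q : ℂ) ^ n * ξ) = (q : ℂ) ^ n * ξ / r ^ 2 by rw [hrq]; ring,
      show (q : ℂ) * ((q : ℂ) ^ n * ξ) = r ^ 2 * ((q : ℂ) ^ n * ξ) by rw [hrq]]
    linear_combination G n * hker - P n * hg)
  linear_combination hzero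

theorem zpow_mul_cpow_shift {q : ℝ} (hq : 0 < q) {ξ : ℂ} (hξ : ξ ≠ 0) (a : ℝ) (n j : ℤ) :
    ((q : ℂ) ^ (n + j) * ξ) ^ (a : ℂ) = qpow q (j * a) * ((q : ℂ) ^ n * ξ) ^ (a : ℂ) := by
  have hqc : (q : ℂ) ≠ 0 := by exact_mod_cast hq.ne'
  rw [add_comm, zpow_add₀ hqc, mul_assoc,
    show (q : ℂ) ^ j = ((q ^ j : ℝ) : ℂ) by push_cast; rfl,
    ofReal_mul_cpow (by positivity) (mul_ne_zero (zpow_ne_zero _ hqc) hξ)]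
  congr 1
  unfold qpow
  rw [← Complex.ofReal_cpow (by positivity), ← Complex.ofReal_cpow hq.le, Real.rpow_mul hq.le,
    Real.rpow_intCast]

theorem P1_zpow_recurrence {q μ μ0 : ℝ} {x ξ : ℂ} (hq0 : 0 < q) (hq1 : q < 1) (hx : x ≠ 0)
    (hxs : ∀ n : ℤ, x ≠ qpow q (μ0 + n) * ξ) (n : ℤ) :
    P1 q μ μ0 x ((q : ℂ) ^ (n + 1) * ξ) * (x - qpow q μ * ((q : ℂ) ^ n * ξ)) =
      P1 q μ μ0 x ((q : ℂ) ^ n * ξ) * (x - qpow q μ0 * ((q : ℂ) ^ n * ξ)) := by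
  have hqc : (q : ℂ) ≠ 0 := by exact_mod_cast hq0.ne'
  have h := hxs n
  rw [qpow_add hq0, qpow_int, mul_assoc] at h
  rw [← P1_shift hq0 hq1 hx h, zpow_add_one₀ hqc]
  congr 2
  ring

theorem P1_isBigO_atTop {q μ μ0 : ℝ} {x ξ : ℂ} (hq0 : 0 < q) (hq1 : q < 1) (hx : x ≠ 0)
    (hxs : ∀ n : ℤ, x ≠ qpow q (μ0 + n) * ξ) :
    (fun n : ℤ => P1 q μ μ0 x ((q : ℂ) ^ n * ξ)) =O[atTop] (fun _ => (1 : ℝ)) := by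
  have h := bounded_of_recurrence hq0 hq1 (qpow q μ * ξ / x) (qpow q μ0 * ξ / x)
    (fun k : ℕ => P1 q μ μ0 x ((q : ℂ) ^ (k : ℤ) * ξ)) fun k => by
      have := P1_zpow_recurrence (μ := μ) hq0 hq1 hx hxs k
      push_cast
      simp only [zpow_natCast] at this ⊢
      generalize P1 q μ μ0 x ((q : ℂ) ^ k * ξ) = p at *
      generalize P1 q μ μ0 x ((q : ℂ) ^ ((k : ℤ) + 1) * ξ) = p' at *
      field_simp
      linear_combination this
  obtain ⟨C, hC⟩ := h.bound
  refine Asymptotics.IsBigO.of_bound C ?_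
  obtain ⟨N, hN⟩ := eventually_atTop.1 hC
  filter_upwards [eventually_ge_atTop (N : ℤ)] with n hn
  lift n to ℕ using by omega
  exact hN n (by exact_mod_cast hn)

theorem P1_isBigO_atBot {q μ μ0 : ℝ} {x ξ : ℂ} (hq0 : 0 < q) (hq1 : q < 1) (hx : x ≠ 0) (hξ : ξ ≠ 0)
    (hxs : ∀ n : ℤ, x ≠ qpow q (μ0 + n) * ξ) :
    (fun n : ℤ => P1 q μ μ0 x ((q : ℂ) ^ n * ξ) * ((q : ℂ) ^ n * ξ) ^ ((μ - μ0 : ℝ) : ℂ))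
      =O[atBot] (fun _ => (1 : ℝ)) := by
  have hqc : (q : ℂ) ≠ 0 := by exact_mod_cast hq0.ne'
  have h := bounded_of_recurrence hq0 hq1 (x * q / (qpow q μ0 * ξ)) (x * q / (qpow q μ * ξ))
    (fun k : ℕ => P1 q μ μ0 x ((q : ℂ) ^ (-(k : ℤ)) * ξ) *
      ((q : ℂ) ^ (-(k : ℤ)) * ξ) ^ ((μ - μ0 : ℝ) : ℂ)) fun k => by
      have hrec := P1_zpow_recurrence (μ := μ) hq0 hq1 hx hxs (-(k : ℤ) - 1)
      have hpow := zpow_mul_cpow_shift hq0 hξ (μ - μ0) (-(k : ℤ)) (-1)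
      have hexp : qpow q (((-1 : ℤ) : ℝ) * (μ - μ0)) = qpow q μ0 * (qpow q μ)⁻¹ := by
        rw [← qpow_neg, ← qpow_add hq0]
        congr 1
        push_cast
        ring
      rw [hexp] at hpow
      rw [show -((k + 1 : ℕ) : ℤ) = -(k : ℤ) + -1 by push_cast; ring, hpow]
      rw [sub_add_cancel, sub_eq_add_neg (-(k : ℤ)) 1, zpow_add₀ hqc (-(k : ℤ)) (-1), zpow_neg_one, zpow_neg,
        zpow_natCast] at hrec
      rw [zpow_add₀ hqc (-(k : ℤ)) (-1), zpow_neg_one, zpow_neg, zpow_natCast]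
      have h1 := qpow_ne_zero hq0 μ
      have h2 := qpow_ne_zero hq0 μ0
      generalize P1 q μ μ0 x (((q : ℂ) ^ k)⁻¹ * (q : ℂ)⁻¹ * ξ) = p at *
      generalize P1 q μ μ0 x (((q : ℂ) ^ k)⁻¹ * ξ) = p' at *
      generalize (((q : ℂ) ^ k)⁻¹ * ξ) ^ ((μ - μ0 : ℝ) : ℂ) = w at *
      have h3 : (q : ℂ) ^ k ≠ 0 := pow_ne_zero _ hqc
      generalize (q : ℂ) ^ k = z at *
      field_simp at hrec ⊢
      linear_combination w * hrec
  obtain ⟨C, hC⟩ := h.bound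
  refine Asymptotics.IsBigO.of_bound C ?_
  obtain ⟨N, hN⟩ := eventually_atTop.1 hC
  filter_upwards [eventually_le_atBot (-(N : ℤ))] with n hn
  obtain ⟨k, rfl⟩ : ∃ k : ℕ, n = -(k : ℤ) := ⟨n.natAbs, by omega⟩
  exact hN k (by omega)

theorem tendsto_mul_P1_atTop {q μ μ0 m : ℝ} {x ξ : ℂ} (hq0 : 0 < q) (hq1 : q < 1) (hx : x ≠ 0)
    (hξ : ξ ≠ 0) (hxs : ∀ n : ℤ, x ≠ qpow q (μ0 + n) * ξ) {h : ℂ → ℂ}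
    (hC1 : Tendsto
      (fun L : ℤ => h ((q : ℂ) ^ L * ξ) / ((q : ℂ) ^ L * ξ) ^ ((m + 1 : ℝ) : ℂ)) atTop (𝓝 0))
    (j : ℤ) :
    Tendsto (fun n : ℤ => (1 - (q : ℂ)) * ((q : ℂ) ^ n * ξ) *
      (((q : ℂ) ^ n * ξ) ^ ((-m : ℝ) : ℂ) * h ((q : ℂ) ^ n * ξ)) *
        P1 q μ μ0 x ((q : ℂ) ^ (n + j) * ξ) * ((q : ℂ) ^ n * ξ)⁻¹ ^ 2) atTop (𝓝 0) := by
  have hqc : (q : ℂ) ≠ 0 := by exact_mod_cast hq0.ne'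
  have hO := (P1_isBigO_atTop (μ := μ) hq0 hq1 hx hxs).comp_tendsto
    (tendsto_atTop_add_const_right atTop j tendsto_id)
  have ho := hO.mul_isLittleO ((Asymptotics.isLittleO_one_iff ℝ).2 (hC1.const_mul (1 - (q : ℂ))
    |>.trans_eq (by rw [mul_zero])))
  simp only [Function.comp_def, mul_one] at ho
  refine ((Asymptotics.isLittleO_one_iff ℝ).1 ho).congr fun n => ?_
  have hs : (q : ℂ) ^ n * ξ ≠ 0 := mul_ne_zero (zpow_ne_zero _ hqc) hξ
  simp only [id]
  generalize P1 q μ μ0 x ((q : ℂ) ^ (n + j) * ξ) = p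
  generalize (q : ℂ) ^ n * ξ = s at *
  have hsm : s ^ (m : ℂ) ≠ 0 := by simp [Complex.cpow_eq_zero_iff, hs]
  push_cast
  rw [Complex.cpow_add _ _ hs, Complex.cpow_neg, Complex.cpow_one]
  field_simp

theorem tendsto_mul_P1_atBot {q μ μ0 m a' : ℝ} {x ξ : ℂ} (hq0 : 0 < q) (hq1 : q < 1) (hx : x ≠ 0)
    (hξ : ξ ≠ 0) (hxs : ∀ n : ℤ, x ≠ qpow q (μ0 + n) * ξ) (hμ : μ - μ0 = 2 - a' - m) {h : ℂ → ℂ}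
    (hC2 : Tendsto
      (fun K : ℤ => h ((q : ℂ) ^ K * ξ) / ((q : ℂ) ^ K * ξ) ^ ((-a' - 1 : ℝ) : ℂ)) atBot (𝓝 0))
    (j : ℤ) :
    Tendsto (fun n : ℤ => (1 - (q : ℂ)) * ((q : ℂ) ^ n * ξ) *
      (((q : ℂ) ^ n * ξ) ^ ((-m : ℝ) : ℂ) * h ((q : ℂ) ^ n * ξ)) *
        P1 q μ μ0 x ((q : ℂ) ^ (n + j) * ξ) * ((q : ℂ) ^ n * ξ) ^ 2) atBot (𝓝 0) := by
  have hqc : (q : ℂ) ≠ 0 := by exact_mod_cast hq0.ne'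
  have hO := (P1_isBigO_atBot (μ := μ) hq0 hq1 hx hξ hxs).comp_tendsto
    (tendsto_atBot_add_const_right atBot j tendsto_id)
  have ho := hO.mul_isLittleO ((Asymptotics.isLittleO_one_iff ℝ).2
    (hC2.const_mul ((1 - (q : ℂ)) * (qpow q (j * (μ - μ0)))⁻¹) |>.trans_eq (by rw [mul_zero])))
  simp only [Function.comp_def, mul_one] at ho
  refine ((Asymptotics.isLittleO_one_iff ℝ).1 ho).congr fun n => ?_
  have hs : (q : ℂ) ^ n * ξ ≠ 0 := mul_ne_zero (zpow_ne_zero _ hqc) hξ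
  simp only [id]
  rw [zpow_mul_cpow_shift hq0 hξ]
  have hne := qpow_ne_zero hq0 (j * (μ - μ0))
  rw [hμ] at *
  generalize P1 q μ μ0 x ((q : ℂ) ^ (n + j) * ξ) = p
  generalize (q : ℂ) ^ n * ξ = s at *
  have hsa : s ^ ((-a' - 1 : ℝ) : ℂ) ≠ 0 := by simp [Complex.cpow_eq_zero_iff, hs]
  have hexp : s ^ ((2 - a' - m : ℝ) : ℂ) =
      s ^ ((-a' - 1 : ℝ) : ℂ) * s ^ 3 * s ^ ((-m : ℝ) : ℂ) := by
    rw [← Complex.cpow_ofNat, ← Complex.cpow_add _ _ hs, ← Complex.cpow_add _ _ hs]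
    congr 1
    push_cast
    ring
  rw [hexp]
  field_simp

theorem stmt15 (q : ℝ) (hq0 : 0 < q) (hq1 : q < 1)
    (h1' h2' h3' h4' l1' l2' l3' l4' a' μ0 a : ℝ) (t1 t2 t3 t4 ξ : ℂ)
    (ht1 : t1 ≠ 0) (ht2 : t2 ≠ 0) (ht3 : t3 ≠ 0) (ht4 : t4 ≠ 0) (hξ : ξ ≠ 0) (E' : ℂ)
    (m χ μ l1 l2 l3 l4 h1 h2 h3 h4 : ℝ) (E : ℂ)
    (hm : m = (h1' + h2' + h3' + h4' - l1' - l2' - l3' - l4' - 2 * a' + 2) / 2)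
    (hχ : χ = (l1' + l2' + l3' + l4' - h1' - h2' - h3' - h4') / 2)
    (hE : E = qpow q (2 * μ0 + a - a' + χ) * E')
    (hμ : μ = μ0 + 1 + χ)
    (hl1 : l1 = l1' + μ0) (hl2 : l2 = l2' + μ0) (hl3 : l3 = l3' + μ0) (hl4 : l4 = l4' + μ0)
    (hh1 : h1 = h1' + μ0 + χ) (hh2 : h2 = h2' + μ0 + χ) (hh3 : h3 = h3' + μ0 + χ)
    (hh4 : h4 = h4' + μ0 + χ)
    (h : ℂ → ℂ)
    (heig : ∀ n : ℤ,
      A2 q t1 t2 t3 t4 h1' h2' h3' h4' l1' l2' l3' l4' a' h ((q : ℂ) ^ n * ξ)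
        = E' * h ((q : ℂ) ^ n * ξ))
    (hC1 : Filter.Tendsto
      (fun L : ℤ => h ((q : ℂ) ^ L * ξ) / ((q : ℂ) ^ L * ξ) ^ ((m + 1 : ℝ) : ℂ))
      Filter.atTop (nhds 0))
    (hC2 : Filter.Tendsto
      (fun K : ℤ => h ((q : ℂ) ^ K * ξ) / ((q : ℂ) ^ K * ξ) ^ ((-a' - 1 : ℝ) : ℂ))
      Filter.atBot (nhds 0)) :
    ∃ J : ℂ → ℂ,
      (∀ y : ℂ, y ≠ 0 → (∀ n : ℤ, y ≠ qpow q (μ0 + n) * ξ) →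
        HasBilatSum (fun n : ℤ =>
          (1 - (q : ℂ)) * ((q : ℂ) ^ n * ξ) *
            (((q : ℂ) ^ n * ξ) ^ ((-m : ℝ) : ℂ) * h ((q : ℂ) ^ n * ξ) *
              P1 q μ μ0 y ((q : ℂ) ^ n * ξ))) (J y)) ∧
      (∀ x : ℂ, x ≠ 0 → (∀ n : ℤ, x ≠ qpow q (μ0 + n) * ξ) →
        A2 q t1 t2 t3 t4 h1 h2 h3 h4 l1 l2 l3 l4 a (fun y => y ^ ((-a : ℝ) : ℂ) * J y) x
          = E * (x ^ ((-a : ℝ) : ℂ) * J x)) := by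
  have hqc : (q : ℂ) ≠ 0 := by exact_mod_cast hq0.ne'
  have hs0 : ∀ n : ℤ, (q : ℂ) ^ n * ξ ≠ 0 := fun n => mul_ne_zero (zpow_ne_zero _ hqc) hξ
  obtain ⟨G, hG⟩ : ∃ G : ℤ → ℂ, ∀ n, (1 - (q : ℂ)) * ((q : ℂ) ^ n * ξ) *
      (((q : ℂ) ^ n * ξ) ^ ((-m : ℝ) : ℂ) * h ((q : ℂ) ^ n * ξ)) = G n := ⟨_, fun _ => rfl⟩
  have hμm : μ - μ0 = 2 - a' - m := by rw [hμ, hχ, hm]; ring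
  have htop := fun (y : ℂ) (hy : y ≠ 0) (hyn : ∀ n : ℤ, y ≠ qpow q (μ0 + n) * ξ) =>
    tendsto_mul_P1_atTop (μ := μ) hq0 hq1 hy hξ hyn hC1
  have hbot := fun (y : ℂ) (hy : y ≠ 0) (hyn : ∀ n : ℤ, y ≠ qpow q (μ0 + n) * ξ) =>
    tendsto_mul_P1_atBot hq0 hq1 hy hξ hyn hμm hC2
  simp only [hG] at htop hbot
  have hconv : ∀ y : ℂ, ∃ S, y ≠ 0 → (∀ n : ℤ, y ≠ qpow q (μ0 + n) * ξ) →
      HasBilatSum (fun n => G n * P1 q μ μ0 y ((q : ℂ) ^ n * ξ)) S := by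
    intro y
    by_cases hy : y ≠ 0 ∧ ∀ n : ℤ, y ≠ qpow q (μ0 + n) * ξ
    · have ht := htop y hy.1 hy.2 0
      have hb := hbot y hy.1 hy.2 0
      simp only [add_zero] at ht hb
      obtain ⟨S, hS⟩ := exists_hasBilatSum hq0 hq1 hξ ht hb
      exact ⟨S, fun _ _ => hS⟩
    · exact ⟨0, fun h1 h2 => absurd ⟨h1, h2⟩ hy⟩
  choose J hJ using hconv
  refine ⟨J, fun y hy hyn => ?_, fun x hx hxn => ?_⟩
  · convert hJ y hy hyn using 2 with n
    rw [← hG]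
    ring
  have hxq : ∀ n : ℤ, x / (q : ℂ) ≠ qpow q (μ0 + n) * ξ := fun n hn => hxn (n + 1) (by
    rw [div_eq_iff hqc] at hn
    rw [hn]
    push_cast
    rw [← add_assoc, qpow_add hq0 _ 1, qpow_one]
    ring)
  have hqx : ∀ n : ℤ, (q : ℂ) * x ≠ qpow q (μ0 + n) * ξ := fun n hn => hxn (n - 1) (by
    push_cast
    rw [← add_sub_assoc, sub_eq_add_neg, qpow_add hq0 _ (-1), qpow_neg, qpow_one]
    field_simp
    linear_combination hn)
  have hJp := hJ (x / q) (div_ne_zero hx hqc) hxq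
  have hJm := hJ (q * x) (mul_ne_zero hqc hx) hqx
  have hJ0 := hJ x hx hxn
  have hPp : ∀ n : ℤ, P1 q μ μ0 (x / q) ((q : ℂ) ^ n * ξ) =
      P1 q μ μ0 x ((q : ℂ) ^ (n + 1) * ξ) := fun n => by
    rw [P1_mul_left hqc, zpow_add_one₀ hqc]
    congr 1
    ring
  have hPm : ∀ n : ℤ, P1 q μ μ0 (q * x) ((q : ℂ) ^ n * ξ) =
      P1 q μ μ0 x ((q : ℂ) ^ (n - 1) * ξ) := fun n => by
    rw [show (q : ℂ) * x = x / (q : ℂ)⁻¹ by field_simp, P1_mul_left (inv_ne_zero hqc),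
      zpow_sub_one₀ hqc]
    congr 1
    ring
  simp only [hPp] at hJp
  simp only [hPm] at hJm
  obtain ⟨r, hr⟩ : ∃ r, r = qpow q (1 / 2) := ⟨_, rfl⟩
  have hr0 : r ≠ 0 := hr ▸ qpow_ne_zero hq0 _
  have hrq : r ^ 2 = q := hr ▸ qpow_half_sq hq0
  obtain ⟨c, hc⟩ : ∃ c, c = qpow q χ := ⟨_, rfl⟩
  have hc0 : c ≠ 0 := hc ▸ qpow_ne_zero hq0 _
  obtain ⟨M, hM⟩ : ∃ M, M = qpow q μ0 := ⟨_, rfl⟩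
  have hM0 : M ≠ 0 := hM ▸ qpow_ne_zero hq0 _
  obtain ⟨α', hα'⟩ : ∃ α', α' = qpow q a' := ⟨_, rfl⟩
  have hα0 : α' ≠ 0 := hα' ▸ qpow_ne_zero hq0 _
  have hμM : qpow q μ = M * c * q := by
    rw [hμ, add_right_comm, qpow_add hq0, qpow_add hq0, qpow_one, ← hM, ← hc]
  have hP := P1_zpow_recurrence (μ := μ) hq0 hq1 hx hxn
  rw [hμM, ← hM] at hP
  -- the weight `s ^ (1 - m)` is multiplied by `q ^ (1 - m) = c * α'` under `s ↦ q * s`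
  have hcα : qpow q (-m) * q = c * α' := by
    rw [hc, hα', ← qpow_one q, ← qpow_add hq0, ← qpow_add hq0]
    congr 1
    rw [hm, hχ]
    ring
  have hcα0 : c * α' ≠ 0 := mul_ne_zero hc0 hα0
  have hw : ∀ n : ℤ, (q : ℂ) ^ (n + 1) * ξ * ((q : ℂ) ^ (n + 1) * ξ) ^ ((-m : ℝ) : ℂ) =
      c * α' * ((q : ℂ) ^ n * ξ * ((q : ℂ) ^ n * ξ) ^ ((-m : ℝ) : ℂ)) := fun n => by
    rw [zpow_mul_cpow_shift hq0 hξ, zpow_add_one₀ hqc, Int.cast_one, one_mul, ← hcα]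
    ring
  have hGm : ∀ n : ℤ, (1 - (q : ℂ)) * ((q : ℂ) ^ n * ξ * ((q : ℂ) ^ n * ξ) ^ ((-m : ℝ) : ℂ)) *
      h ((q : ℂ) ^ n * ξ / q) = c * α' * G (n - 1) := fun n => by
    have := hw (n - 1)
    rw [sub_add_cancel] at this
    rw [this, show (q : ℂ) ^ n * ξ / q = (q : ℂ) ^ (n - 1) * ξ by rw [zpow_sub_one₀ hqc]; ring,
      ← hG]
    ring
  have hGp : ∀ n : ℤ, (1 - (q : ℂ)) * ((q : ℂ) ^ n * ξ * ((q : ℂ) ^ n * ξ) ^ ((-m : ℝ) : ℂ)) *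
      h (q * ((q : ℂ) ^ n * ξ)) = (c * α')⁻¹ * G (n + 1) := fun n => by
    rw [eq_inv_mul_iff_mul_eq₀ hcα0,
      show (q : ℂ) * ((q : ℂ) ^ n * ξ) = (q : ℂ) ^ (n + 1) * ξ by rw [zpow_add_one₀ hqc]; ring,
      ← hG]
    linear_combination -(1 - (q : ℂ)) * h ((q : ℂ) ^ (n + 1) * ξ) * hw n
  obtain ⟨a1, ha1⟩ : ∃ a1, a1 = qpow q h1' * r * t1 := ⟨_, rfl⟩
  obtain ⟨a2, ha2⟩ : ∃ a2, a2 = qpow q h2' * r * t2 := ⟨_, rfl⟩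
  obtain ⟨a3, ha3⟩ : ∃ a3, a3 = qpow q h3' * r * t3 := ⟨_, rfl⟩
  obtain ⟨a4, ha4⟩ : ∃ a4, a4 = qpow q h4' * r * t4 := ⟨_, rfl⟩
  obtain ⟨b1, hb1⟩ : ∃ b1, b1 = qpow q l1' * r⁻¹ * t1 := ⟨_, rfl⟩
  obtain ⟨b2, hb2⟩ : ∃ b2, b2 = qpow q l2' * r⁻¹ * t2 := ⟨_, rfl⟩
  obtain ⟨b3, hb3⟩ : ∃ b3, b3 = qpow q l3' * r⁻¹ * t3 := ⟨_, rfl⟩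
  obtain ⟨b4, hb4⟩ : ∃ b4, b4 = qpow q l4' * r⁻¹ * t4 := ⟨_, rfl⟩
  have hrecG : ∀ n : ℤ, E' * G n =
      c * α' * laurentQuartic (a1 + a2 + a3 + a4)
          (a1 * a2 + a1 * a3 + a1 * a4 + a2 * a3 + a2 * a4 + a3 * a4)
          (a1 * a2 * a3 + a1 * a2 * a4 + a1 * a3 * a4 + a2 * a3 * a4)
          (a1 * a2 * a3 * a4) ((q : ℂ) ^ n * ξ) * G (n - 1)
      + α' * r ^ 2 * c⁻¹ * laurentQuartic (b1 + b2 + b3 + b4)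
          (b1 * b2 + b1 * b3 + b1 * b4 + b2 * b3 + b2 * b4 + b3 * b4)
          (b1 * b2 * b3 + b1 * b2 * b4 + b1 * b3 * b4 + b2 * b3 * b4)
          (c ^ 2 * (a1 * a2 * a3 * a4) * r⁻¹ ^ 8) ((q : ℂ) ^ n * ξ) * G (n + 1)
      + α' * r * midCoeff r c (a1 + a2 + a3 + a4)
          (a1 * a2 * a3 + a1 * a2 * a4 + a1 * a3 * a4 + a2 * a3 * a4) (a1 * a2 * a3 * a4)
          (b1 + b2 + b3 + b4) (b1 * b2 * b3 + b1 * b2 * b4 + b1 * b3 * b4 + b2 * b3 * b4)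
          ((q : ℂ) ^ n * ξ) * G n := by
    intro n
    have he := heig n
    rw [A2_eq_laurent hq0 ht1 ht2 ht3 ht4 _ _ _ _ _ _ _ _ _ _ (hs0 n) hr
      (hc.trans (by rw [hχ])) ha1 ha2 ha3 ha4 hb1 hb2 hb3 hb4, ← hα'] at he
    have hGn : (1 - (q : ℂ)) * ((q : ℂ) ^ n * ξ * ((q : ℂ) ^ n * ξ) ^ ((-m : ℝ) : ℂ)) *
        h ((q : ℂ) ^ n * ξ) = G n := by
      rw [← hG]
      ring
    have hgp := hGp n
    have hgm := hGm n
    generalize (1 - (q : ℂ)) * ((q : ℂ) ^ n * ξ * ((q : ℂ) ^ n * ξ) ^ ((-m : ℝ) : ℂ)) = w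
      at hGn hgp hgm
    generalize laurentQuartic (a1 + a2 + a3 + a4) _ _ _ ((q : ℂ) ^ n * ξ) = LA at he ⊢
    generalize laurentQuartic (b1 + b2 + b3 + b4) _ _ _ ((q : ℂ) ^ n * ξ) = LB at he ⊢
    generalize midCoeff r c (a1 + a2 + a3 + a4) _ _ _ _ ((q : ℂ) ^ n * ξ) = LC at he ⊢
    have hgp' : w * h (q * ((q : ℂ) ^ n * ξ)) * α' = c⁻¹ * G (n + 1) := by
      rw [hgp]
      field_simp
    linear_combination LA * hgm + α' * r ^ 2 * LB * hgp' - w * he + (α' * r * LC - E') * hGn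
  have hmain := bilatSum_eigen (E' := E') (α := α') (x := x) (G := G)
    (P := fun n => P1 q μ μ0 x ((q : ℂ) ^ n * ξ))
    (A1 := a1 + a2 + a3 + a4)
    (A2 := a1 * a2 + a1 * a3 + a1 * a4 + a2 * a3 + a2 * a4 + a3 * a4)
    (A3 := a1 * a2 * a3 + a1 * a2 * a4 + a1 * a3 * a4 + a2 * a3 * a4)
    (A4 := a1 * a2 * a3 * a4)
    (B1 := b1 + b2 + b3 + b4)
    (B2 := b1 * b2 + b1 * b3 + b1 * b4 + b2 * b3 + b2 * b4 + b3 * b4)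
    (B3 := b1 * b2 * b3 + b1 * b2 * b4 + b1 * b3 * b4 + b2 * b3 * b4)
    hq0 hq1 hξ hr0 hrq hc0 hM0 hα0 hx hP hrecG
    (htop x hx hxn) (hbot x hx hxn) hJ0 hJp hJm
  generalize hLA : laurentQuartic (M * c * (a1 + a2 + a3 + a4)) _ _ _ x = LA at hmain
  generalize hLB : laurentQuartic (M * (b1 + b2 + b3 + b4)) _ _ _ x = LB at hmain
  generalize hLC : midCoeff r c⁻¹ (M * c * (a1 + a2 + a3 + a4)) _ _ _ _ x = LC at hmain
  have hnh : ∀ y t : ℂ, ∀ p : ℝ, y = qpow q p * r * t → M * c * y = qpow q (p + μ0 + χ) * r * t :=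
    fun y t p hy => by
      rw [hy, qpow_add hq0, qpow_add hq0, hM, hc]
      ring
  have hnl : ∀ y t : ℂ, ∀ p : ℝ, y = qpow q p * r⁻¹ * t → M * y = qpow q (p + μ0) * r⁻¹ * t :=
    fun y t p hy => by
      rw [hy, qpow_add hq0, hM]
      ring
  have hcinv : c⁻¹ = qpow q ((l1 + l2 + l3 + l4 - h1 - h2 - h3 - h4) / 2) := by
    rw [hc, ← qpow_neg]
    congr 1
    rw [hl1, hl2, hl3, hl4, hh1, hh2, hh3, hh4, hχ]
    ring
  rw [A2_eq_laurent hq0 ht1 ht2 ht3 ht4 _ _ _ _ _ _ _ _ _ _ hx hr hcinv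
    (hh1 ▸ hnh _ _ _ ha1) (hh2 ▸ hnh _ _ _ ha2) (hh3 ▸ hnh _ _ _ ha3)
    (hh4 ▸ hnh _ _ _ ha4)
    (hl1 ▸ hnl _ _ _ hb1) (hl2 ▸ hnl _ _ _ hb2) (hl3 ▸ hnl _ _ _ hb3) (hl4 ▸ hnl _ _ _ hb4)]
  have hEq : E = M ^ 2 * c * α'⁻¹ * qpow q a * E' := by
    rw [hE, hα', hM, hc, sq, ← qpow_neg, ← qpow_add hq0, ← qpow_add hq0, ← qpow_add hq0,
      ← qpow_add hq0]
    congr 2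
    ring
  have hqa0 := qpow_ne_zero hq0 a
  have hpowm : ((q : ℂ) * x) ^ ((-a : ℝ) : ℂ) = (qpow q a)⁻¹ * x ^ ((-a : ℝ) : ℂ) := by
    rw [ofReal_mul_cpow hq0 hx, qpow_neg]
  have hpowp : (x / (q : ℂ)) ^ ((-a : ℝ) : ℂ) = qpow q a * x ^ ((-a : ℝ) : ℂ) := by
    have := ofReal_mul_cpow hq0 (div_ne_zero hx hqc) (-a)
    rw [mul_div_cancel₀ _ hqc, qpow_neg] at this
    rw [this]
    field_simp
  have eA : laurentQuartic (M * c * a1 + M * c * a2 + M * c * a3 + M * c * a4)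
      (M * c * a1 * (M * c * a2) + M * c * a1 * (M * c * a3) + M * c * a1 * (M * c * a4)
        + M * c * a2 * (M * c * a3) + M * c * a2 * (M * c * a4) + M * c * a3 * (M * c * a4))
      (M * c * a1 * (M * c * a2) * (M * c * a3) + M * c * a1 * (M * c * a2) * (M * c * a4)
        + M * c * a1 * (M * c * a3) * (M * c * a4) + M * c * a2 * (M * c * a3) * (M * c * a4))
      (M * c * a1 * (M * c * a2) * (M * c * a3) * (M * c * a4)) x = LA := by
    rw [← hLA]
    congr 1 <;> ring
  have eB : laurentQuartic (M * b1 + M * b2 + M * b3 + M * b4)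
      (M * b1 * (M * b2) + M * b1 * (M * b3) + M * b1 * (M * b4)
        + M * b2 * (M * b3) + M * b2 * (M * b4) + M * b3 * (M * b4))
      (M * b1 * (M * b2) * (M * b3) + M * b1 * (M * b2) * (M * b4)
        + M * b1 * (M * b3) * (M * b4) + M * b2 * (M * b3) * (M * b4))
      (c⁻¹ ^ 2 * (M * c * a1 * (M * c * a2) * (M * c * a3) * (M * c * a4)) * r⁻¹ ^ 8) x = LB := by
    rw [← hLB]
    congr 1
    · ring
    · ring
    · ring
    · field_simp
  have eC : midCoeff r c⁻¹ (M * c * a1 + M * c * a2 + M * c * a3 + M * c * a4)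
      (M * c * a1 * (M * c * a2) * (M * c * a3) + M * c * a1 * (M * c * a2) * (M * c * a4)
        + M * c * a1 * (M * c * a3) * (M * c * a4) + M * c * a2 * (M * c * a3) * (M * c * a4))
      (M * c * a1 * (M * c * a2) * (M * c * a3) * (M * c * a4))
      (M * b1 + M * b2 + M * b3 + M * b4)
      (M * b1 * (M * b2) * (M * b3) + M * b1 * (M * b2) * (M * b4)
        + M * b1 * (M * b3) * (M * b4) + M * b2 * (M * b3) * (M * b4)) x = LC := by
    rw [← hLC]
    congr 1 <;> ring
  rw [eA, eB, eC, hpowm, hpowp, hEq]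
  field_simp
  field_simp at hmain
  linear_combination x ^ ((-a : ℝ) : ℂ) * hmain
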